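/- Let T̄ be an upper transition operator on ℒ(X) with a closed class S (in 𝒢(T̄)) that is absorbing. Then for every f ∈ ℒ(X) and every y ∈ X: min_{x∈S} liminf_{k→∞} (1/k)·[T̄_f^k(0)](x) ≤ liminf_{k→∞} (1/k)·[T̄_f^k(0)](y) ≤ limsup_{k→∞} (1/k)·[T̄_f^k(0)](y) ≤ max_{x∈S} limsup_{k→∞} (1/k)·[T̄_f^k(0)](x). -/

import Mathlib

open Filter Topology

namespace WeakErg

variable {X : Type*} [Fintype X] [Nonempty X]

/-- Indicator function of a set, as a real-valued function. -/
noncomputable def ind (A : Set X) : X → ℝ := A.indicator 1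

/-- Upper transition operator axioms: dominated by the max, sub-additive,
non-negatively homogeneous. -/
def IsUTO (T : (X → ℝ) → (X → ℝ)) : Prop :=
  (∀ (h : X → ℝ) (x : X), T h x ≤ ⨆ y, h y) ∧
  (∀ (h g : X → ℝ) (x : X), T (h + g) x ≤ T h x + T g x) ∧
  (∀ (l : ℝ), 0 ≤ l → ∀ h : X → ℝ, T (l • h) = l • T h)

/-- The topical map `T̄_f : h ↦ f + T̄ h`. -/
def Tf (T : (X → ℝ) → (X → ℝ)) (f : X → ℝ) : (X → ℝ) → (X → ℝ) :=
  fun h => f + T h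

/-- Edge relation of the (upper) accessibility graph 𝒢(T): an edge from `x` to `y`
iff `[T 𝟙_y](x) > 0`. -/
def Edge (T : (X → ℝ) → (X → ℝ)) (x y : X) : Prop := 0 < T (ind {y}) x

/-- Accessibility: `x = y` or there is a directed path from `x` to `y`. -/
def Acc' (T : (X → ℝ) → (X → ℝ)) : X → X → Prop := Relation.ReflTransGen (Edge T)

/-- `x` and `y` communicate. -/
def Comm (T : (X → ℝ) → (X → ℝ)) (x y : X) : Prop := Acc' T x y ∧ Acc' T y x

/-- `S` is a communication class: an equivalence class of the communication relation. -/
def IsCommClass (T : (X → ℝ) → (X → ℝ)) (S : Set X) : Prop :=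
  ∃ x : X, S = {y | Comm T x y}

/-- A nonempty set `S` is closed in 𝒢(T): no state outside `S` is accessible from `S`. -/
def ClosedIn (T : (X → ℝ) → (X → ℝ)) (S : Set X) : Prop :=
  S.Nonempty ∧ ∀ x ∈ S, ∀ y ∉ S, ¬ Acc' T x y

/-- 𝒢(T) is strongly connected. -/
def StronglyConnected (T : (X → ℝ) → (X → ℝ)) : Prop := ∀ x y : X, Acc' T x y

/-- A set `S` is absorbing for `T`: from each state outside `S` the `k`-step upper
probability of staying outside `S` drops below 1 for some `k`. -/
def Absorbing (T : (X → ℝ) → (X → ℝ)) (S : Set X) : Prop :=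
  ∀ x ∉ S, ∃ k : ℕ, T^[k] (ind Sᶜ) x < 1

/-- `R` is a top class of 𝒢(T): a communication class accessible from every state. -/
def IsTopClass (T : (X → ℝ) → (X → ℝ)) (R : Set X) : Prop :=
  IsCommClass T R ∧ ∀ x : X, ∀ y ∈ R, Acc' T x y

/-- (TCA): 𝒢(T) has a top class that is absorbing. -/
def TCA (T : (X → ℝ) → (X → ℝ)) : Prop :=
  ∃ R : Set X, IsTopClass T R ∧ Absorbing T R

/-- `T` is weakly ergodic: for every `f`, the upper expected time averages
`(1/k)·[T̄_f^k(0)](x)` converge to a limit independent of `x`. -/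
def WeaklyErgodic (T : (X → ℝ) → (X → ℝ)) : Prop :=
  ∀ f : X → ℝ, ∃ μ : ℝ, ∀ x : X,
    Tendsto (fun k : ℕ => (1 / (k : ℝ)) * (Tf T f)^[k] 0 x) atTop (𝓝 μ)

/-- `μ` is an additive eigenvalue of `G`. -/
def IsAddEigenvalue (G : (X → ℝ) → (X → ℝ)) (μ : ℝ) : Prop :=
  ∃ h : X → ℝ, G h = h + fun _ => μ

/-- A transition matrix on `X`: nonnegative entries with rows summing to one. -/
structure TransMat (Y : Type*) [Fintype Y] where
  P : Y → Y → ℝ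
  nonneg : ∀ x y, 0 ≤ P x y
  rowSum : ∀ x, ∑ y, P x y = 1

/-- The action of a transition matrix on functions. -/
def TransMat.apply (T : TransMat X) (h : X → ℝ) : X → ℝ :=
  fun x => ∑ y, T.P x y * h y

/-- A set of transition matrices is separately specified. -/
def SepSpec (𝒯 : Set (TransMat X)) : Prop :=
  ∀ T₁ ∈ 𝒯, ∀ T₂ ∈ 𝒯, ∀ A : Set X, ∃ T₃ ∈ 𝒯,
    (∀ x ∈ A, T₃.P x = T₁.P x) ∧ (∀ y ∉ A, T₃.P y = T₂.P y)

/-- `Tbar` is the upper envelope of the set `𝒯` of transition matrices. -/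
def IsUpperEnv (𝒯 : Set (TransMat X)) (Tbar : (X → ℝ) → (X → ℝ)) : Prop :=
  ∀ (h : X → ℝ) (x : X), Tbar h x = ⨆ T : 𝒯, TransMat.apply T.1 h x

/-- The repetition-independent upper expected time average
`sup_{T ∈ 𝒯} (1/k)·[T_f^k(0)](x)`. -/
noncomputable def riSeq (𝒯 : Set (TransMat X)) (f : X → ℝ) (x : X) (k : ℕ) : ℝ :=
  ⨆ T : 𝒯, (1 / (k : ℝ)) * (Tf (TransMat.apply T.1) f)^[k] 0 x

/-- Weak ergodicity of the imprecise Markov chain under repetition independence. -/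
def RIWeaklyErgodic (𝒯 : Set (TransMat X)) : Prop :=
  ∀ f : X → ℝ, ∃ μ : ℝ, ∀ x : X, Tendsto (riSeq 𝒯 f x) atTop (𝓝 μ)

end WeakErg

namespace WeakErg

section Helpers

variable {X : Type*} [Fintype X] [Nonempty X]

lemma uto_zero {T : (X → ℝ) → (X → ℝ)} (hT : IsUTO T) : T 0 = 0 := by
  have := hT.2.2 0 le_rfl 0
  simpa using this

lemma uto_key {T : (X → ℝ) → (X → ℝ)} (hT : IsUTO T) (h g : X → ℝ) (c : ℝ)
    (hc : ∀ x, h x ≤ g x + c) (x : X) : T h x ≤ T g x + c := by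
  have h1 := hT.2.1 g (h - g) x
  have h2 := hT.1 (h - g) x
  have h3 : (⨆ y, (h - g) y) ≤ c := ciSup_le fun y => by
    have := hc y
    simp only [Pi.sub_apply]; linarith
  rw [add_sub_cancel] at h1
  linarith

lemma uto_iter {T : (X → ℝ) → (X → ℝ)} (hT : IsUTO T) (n : ℕ) : IsUTO (T^[n]) := by
  induction n with
  | zero =>
    refine ⟨fun h x => ?_, fun h g x => ?_, fun l _ h => ?_⟩
    · exact le_ciSup (f := h) (Set.finite_range h).bddAbove x
    · simp
    · simp
  | succ n ih =>
    refine ⟨fun h x => ?_, fun h g x => ?_, fun l hl h => ?_⟩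
    · rw [Function.iterate_succ_apply']
      exact (hT.1 _ x).trans (ciSup_le fun y => ih.1 h y)
    · simp only [Function.iterate_succ_apply']
      have h1 := uto_key hT (T^[n] (h + g)) (T^[n] h + T^[n] g) 0
        (fun x => by have := ih.2.1 h g x; simpa using this) x
      have h2 := hT.2.1 (T^[n] h) (T^[n] g) x
      linarith
    · simp only [Function.iterate_succ_apply']
      rw [ih.2.2 l hl, hT.2.2 l hl]

lemma uto_nonneg {T : (X → ℝ) → (X → ℝ)} (hT : IsUTO T) (h : X → ℝ) (hh : ∀ x, 0 ≤ h x)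
    (x : X) : 0 ≤ T h x := by
  have := uto_key hT 0 h 0 (fun x => by simpa using hh x) x
  rw [uto_zero hT] at this
  simpa using this

lemma ind_nonneg (A : Set X) (x : X) : 0 ≤ ind A x := by
  unfold ind
  exact Set.indicator_nonneg (by simp) x

lemma ind_le_one (A : Set X) (x : X) : ind A x ≤ 1 := by
  classical
  unfold ind
  rw [Set.indicator_apply]; split_ifs <;> simp

lemma uto_sum {T : (X → ℝ) → (X → ℝ)} (hT : IsUTO T) {ι : Type*} (s : Finset ι)
    (F : ι → X → ℝ) (x : X) : T (∑ i ∈ s, F i) x ≤ ∑ i ∈ s, T (F i) x := by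
  classical
  induction s using Finset.induction_on with
  | empty => simp [uto_zero hT]
  | insert a s ha ih =>
    rw [Finset.sum_insert ha, Finset.sum_insert ha]
    have := hT.2.1 (F a) (∑ i ∈ s, F i) x
    linarith

lemma T_ind_compl {T : (X → ℝ) → (X → ℝ)} (hT : IsUTO T) {S : Set X} (hcl : ClosedIn T S)
    (x : X) : T (ind Sᶜ) x ≤ ind Sᶜ x := by
  classical
  by_cases hx : x ∈ S
  · have e : ind Sᶜ = ∑ y ∈ Finset.univ.filter (fun y => y ∉ S), ind ({y} : Set X) := by
      funext z
      simp [ind, Set.indicator_apply, Finset.sum_apply]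
    have h1 := uto_sum hT (Finset.univ.filter (fun y => y ∉ S)) (fun y => ind ({y} : Set X)) x
    rw [← e] at h1
    have h2 : ∑ y ∈ Finset.univ.filter (fun y => y ∉ S), T (ind ({y} : Set X)) x ≤ 0 := by
      refine Finset.sum_nonpos fun y hy => ?_
      by_contra hc
      exact hcl.2 x hx y (by simpa using hy) (Relation.ReflTransGen.single (not_le.mp hc))
    have h3 := ind_nonneg Sᶜ x
    linarith
  · have h1 : ind Sᶜ x = 1 := by simp [ind, hx]
    rw [h1]
    exact (hT.1 _ x).trans (ciSup_le fun y => ind_le_one _ y)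

lemma T_iter_anti {T : (X → ℝ) → (X → ℝ)} (hT : IsUTO T) {S : Set X} (hcl : ClosedIn T S)
    (k n : ℕ) (x : X) : T^[n + k] (ind Sᶜ) x ≤ T^[n] (ind Sᶜ) x := by
  induction k with
  | zero => simp
  | succ k ih =>
    rw [← add_assoc, Function.iterate_succ_apply]
    have := uto_key (uto_iter hT (n + k)) (T (ind Sᶜ)) (ind Sᶜ) 0
      (fun x => by simpa using T_ind_compl hT hcl x) x
    linarith

lemma exists_unif {T : (X → ℝ) → (X → ℝ)} (hT : IsUTO T) {S : Set X} (hcl : ClosedIn T S)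
    (habs : Absorbing T S) :
    ∃ N : ℕ, 0 < N ∧ ∃ e : ℝ, 0 < e ∧ ∀ x, T^[N] (ind Sᶜ) x ≤ 1 - e := by
  classical
  have hk : ∀ x, ∃ k : ℕ, T^[k] (ind Sᶜ) x < 1 := by
    intro x
    by_cases hx : x ∈ S
    · exact ⟨0, by simp [ind, hx]⟩
    · exact habs x hx
  choose k hk using hk
  let N := (∑ x, k x) + 1
  have hN : ∀ x, T^[N] (ind Sᶜ) x < 1 := by
    intro x
    have h1 : k x ≤ N :=
      (Finset.single_le_sum (f := k) (fun _ _ => Nat.zero_le _) (Finset.mem_univ x)).trans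
        (Nat.le_succ _)
    obtain ⟨d, hd⟩ := Nat.exists_eq_add_of_le h1
    rw [hd]
    exact (T_iter_anti hT hcl d (k x) x).trans_lt (hk x)
  obtain ⟨x0, hx0⟩ := Finite.exists_max (fun x => T^[N] (ind Sᶜ) x)
  refine ⟨N, Nat.succ_pos _, 1 - T^[N] (ind Sᶜ) x0, by linarith [hN x0], fun x => ?_⟩
  have := hx0 x
  linarith

variable {T : (X → ℝ) → (X → ℝ)} {f : X → ℝ} {M : ℝ}

lemma Tf_key (hT : IsUTO T) (h g : X → ℝ) (c : ℝ)
    (hc : ∀ x, h x ≤ g x + c) (x : X) : Tf T f h x ≤ Tf T f g x + c := by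
  have := uto_key hT h g c hc x
  simp only [Tf, Pi.add_apply]; linarith

lemma g_step (hT : IsUTO T) (hM : ∀ x, |f x| ≤ M) (k : ℕ) :
    ∀ x, (Tf T f)^[k + 1] 0 x ≤ (Tf T f)^[k] 0 x + M ∧
      (Tf T f)^[k] 0 x ≤ (Tf T f)^[k + 1] 0 x + M := by
  induction k with
  | zero =>
    intro x
    have := abs_le.mp (hM x)
    simp only [zero_add, Function.iterate_one, Function.iterate_zero, id, Tf, uto_zero hT,
      Pi.add_apply, Pi.zero_apply]
    constructor <;> linarith
  | succ k ih =>
    intro x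
    rw [Function.iterate_succ_apply' _ (k + 1), Function.iterate_succ_apply' _ k]
    rw [Function.iterate_succ_apply' _ k] at ih
    exact ⟨Tf_key hT _ _ M (fun x => (ih x).1) x, Tf_key hT _ _ M (fun x => (ih x).2) x⟩

lemma g_steps (hT : IsUTO T) (hM : ∀ x, |f x| ≤ M) (k n : ℕ) (x : X) :
    (Tf T f)^[k + n] 0 x ≤ (Tf T f)^[k] 0 x + n * M ∧
      (Tf T f)^[k] 0 x ≤ (Tf T f)^[k + n] 0 x + n * M := by
  induction n with
  | zero => simp
  | succ n ih =>
    have := g_step hT hM (k + n) x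
    rw [← add_assoc]
    push_cast
    constructor <;> linarith [this.1, this.2, ih.1, ih.2]

lemma g_bound (hT : IsUTO T) (hM : ∀ x, |f x| ≤ M) (k : ℕ) (x : X) :
    |(Tf T f)^[k] 0 x| ≤ k * M := by
  have := g_steps hT hM 0 k x
  simp only [zero_add, Function.iterate_zero, id, Pi.zero_apply] at this
  rw [abs_le]; constructor <;> linarith [this.1, this.2]

lemma Tf_iter_T (hT : IsUTO T) (hM : ∀ x, |f x| ≤ M) (h : X → ℝ) (n : ℕ) :
    ∀ x, (Tf T f)^[n] h x ≤ T^[n] h x + n * M ∧ T^[n] h x ≤ (Tf T f)^[n] h x + n * M := by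
  induction n with
  | zero => simp
  | succ n ih =>
    intro x
    rw [Function.iterate_succ_apply', Function.iterate_succ_apply']
    have h1 := uto_key hT _ _ _ (fun x => (ih x).1) x
    have h2 := uto_key hT _ _ _ (fun x => (ih x).2) x
    have := abs_le.mp (hM x)
    simp only [Tf, Pi.add_apply] at h1 h2 ⊢
    push_cast
    constructor <;> linarith

lemma exists_C (hT : IsUTO T) {S : Set X} (hcl : ClosedIn T S) (habs : Absorbing T S)
    (hM : ∀ x, |f x| ≤ M) :
    ∃ C : ℝ, ∀ k : ℕ, ∀ b : ℝ,
      ((∀ x ∈ S, (Tf T f)^[k] 0 x ≤ b) → ∀ y, (Tf T f)^[k] 0 y ≤ b + C) ∧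
      ((∀ x ∈ S, b ≤ (Tf T f)^[k] 0 x) → ∀ y, b ≤ (Tf T f)^[k] 0 y + C) := by
  obtain ⟨N, hN0, e, he, hN⟩ := exists_unif hT hcl habs
  have hM0 : 0 ≤ M := (abs_nonneg _).trans (hM (Classical.arbitrary X))
  obtain ⟨s, hs⟩ := hcl.1
  have hA : 0 ≤ (N : ℝ) * M := by positivity
  obtain ⟨C, hC⟩ : ∃ C : ℝ, C = 2 * (N * M) / e + 2 * (N * M) := ⟨_, rfl⟩
  have hC0 : 0 ≤ C := by rw [hC]; positivity
  have hC1 : 2 * (N * M) ≤ C := by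
    rw [hC]; have : 0 ≤ 2 * (N * M) / e := by positivity
    linarith
  have hC2 : 2 * (N * M) ≤ C * e := by
    rw [hC, add_mul, div_mul_cancel₀ _ he.ne']
    have : 0 ≤ 2 * (N * M) * e := by positivity
    linarith
  have hU := uto_iter hT N
  have hin : ∀ x ∈ S, ind Sᶜ x = 0 := fun x hx => by simp [ind, hx]
  have hout : ∀ x ∉ S, ind Sᶜ x = 1 := fun x hx => by simp [ind, hx]
  refine ⟨C, fun k => ?_⟩
  induction k using Nat.strong_induction_on with
  | _ k ih =>
  intro b
  rcases lt_or_ge k N with hk | hk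
  · have hb : ∀ x, |(Tf T f)^[k] 0 x| ≤ N * M := fun x =>
      (g_bound hT hM k x).trans (by gcongr)
    have hbs := abs_le.mp (hb s)
    constructor
    · intro h y
      have := abs_le.mp (hb y)
      linarith [h s hs]
    · intro h y
      have := abs_le.mp (hb y)
      linarith [h s hs]
  · obtain ⟨j, rfl⟩ := Nat.exists_eq_add_of_le' hk
    have ihj := ih j (by omega)
    have hst := g_steps hT hM j N
    have hit := Tf_iter_T hT hM ((Tf T f)^[j] 0) N
    have hcomp : (Tf T f)^[j + N] 0 = (Tf T f)^[N] ((Tf T f)^[j] 0) := by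
      rw [add_comm, Function.iterate_add_apply]
    rw [← hcomp] at hit
    have hCU : ∀ y, T^[N] (C • ind Sᶜ) y ≤ C * (1 - e) := by
      intro y
      rw [hU.2.2 C hC0]
      simp only [Pi.smul_apply, smul_eq_mul]
      exact mul_le_mul_of_nonneg_left (hN y) hC0
    constructor
    · intro h y
      have h1 : ∀ x ∈ S, (Tf T f)^[j] 0 x ≤ b + N * M := fun x hx => by
        linarith [h x hx, (hst x).2]
      have h2 := (ihj (b + N * M)).1 h1
      have h3 := uto_key hU ((Tf T f)^[j] 0) (C • ind Sᶜ) (b + N * M) (fun x => by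
        simp only [Pi.smul_apply, smul_eq_mul]
        by_cases hx : x ∈ S
        · rw [hin x hx]; linarith [h1 x hx]
        · rw [hout x hx]; linarith [h2 x]) y
      linarith [hCU y, (hit y).1]
    · intro h y
      have h1 : ∀ x ∈ S, b - N * M ≤ (Tf T f)^[j] 0 x := fun x hx => by
        linarith [h x hx, (hst x).1]
      have h2 := (ihj (b - N * M)).2 h1
      have h3 := uto_key hU (-(C • ind Sᶜ)) ((Tf T f)^[j] 0) (-(b - N * M)) (fun x => by
        simp only [Pi.smul_apply, smul_eq_mul, Pi.neg_apply]
        by_cases hx : x ∈ S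
        · rw [hin x hx]; linarith [h1 x hx]
        · rw [hout x hx]; linarith [h2 x]) y
      have h4 := hU.2.1 (C • ind Sᶜ) (-(C • ind Sᶜ)) y
      rw [add_neg_cancel, uto_zero hU] at h4
      simp only [Pi.zero_apply] at h4
      linarith [hCU y, (hit y).2]

end Helpers

/-- for a closed class `S` of 𝒢(T̄) that is absorbing, the liminf and
limsup of the upper expected time averages started anywhere are sandwiched between
the min of the liminfs over `S` and the max of the limsups over `S`. -/
theorem absorbing_closed_sandwich {X : Type*} [Fintype X] [Nonempty X]
    (T : (X → ℝ) → (X → ℝ)) (hT : IsUTO T) (S : Set X)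
    (hcl : ClosedIn T S) (habs : Absorbing T S) (f : X → ℝ) (y : X) :
    sInf ((fun x : X => Filter.liminf
        (fun k : ℕ => (1 / (k : ℝ)) * (Tf T f)^[k] 0 x) atTop) '' S)
      ≤ Filter.liminf (fun k : ℕ => (1 / (k : ℝ)) * (Tf T f)^[k] 0 y) atTop ∧
    Filter.liminf (fun k : ℕ => (1 / (k : ℝ)) * (Tf T f)^[k] 0 y) atTop
      ≤ Filter.limsup (fun k : ℕ => (1 / (k : ℝ)) * (Tf T f)^[k] 0 y) atTop ∧
    Filter.limsup (fun k : ℕ => (1 / (k : ℝ)) * (Tf T f)^[k] 0 y) atTop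
      ≤ sSup ((fun x : X => Filter.limsup
        (fun k : ℕ => (1 / (k : ℝ)) * (Tf T f)^[k] 0 x) atTop) '' S) := by
  obtain ⟨M, hM⟩ : ∃ M : ℝ, ∀ x, |f x| ≤ M := by
    obtain ⟨x0, h0⟩ := Finite.exists_max (fun x => |f x|)
    exact ⟨_, h0⟩
  have hM0 : 0 ≤ M := (abs_nonneg _).trans (hM y)
  obtain ⟨C, hC⟩ := exists_C hT hcl habs hM
  have hb : ∀ x (k : ℕ), |(1 / (k : ℝ)) * (Tf T f)^[k] 0 x| ≤ M := by
    intro x k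
    rcases Nat.eq_zero_or_pos k with rfl | hk
    · simpa using hM0
    · have hk' : (0 : ℝ) < k := by exact_mod_cast hk
      rw [abs_mul, abs_of_pos (by positivity : (0 : ℝ) < 1 / k), one_div,
        inv_mul_le_iff₀ hk']
      exact g_bound hT hM k x
  have hbu : ∀ x, IsBoundedUnder (· ≤ ·) atTop
      (fun k : ℕ => (1 / (k : ℝ)) * (Tf T f)^[k] 0 x) := fun x =>
    isBoundedUnder_of ⟨M, fun k => (abs_le.mp (hb x k)).2⟩
  have hbl : ∀ x, IsBoundedUnder (· ≥ ·) atTop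
      (fun k : ℕ => (1 / (k : ℝ)) * (Tf T f)^[k] 0 x) := fun x =>
    isBoundedUnder_of ⟨-M, fun k => (abs_le.mp (hb x k)).1⟩
  have hCk : ∀ ε : ℝ, 0 < ε → ∀ᶠ k : ℕ in atTop, C ≤ k * ε := by
    intro ε hε
    have : Tendsto (fun k : ℕ => (k : ℝ) * ε) atTop atTop :=
      tendsto_natCast_atTop_atTop.atTop_mul_const hε
    exact this.eventually_ge_atTop C
  refine ⟨?_, liminf_le_limsup (hbu y) (hbl y), ?_⟩
  · refine le_of_forall_pos_sub_le fun ε hε => ?_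
    set L := sInf ((fun x : X => Filter.liminf
        (fun k : ℕ => (1 / (k : ℝ)) * (Tf T f)^[k] 0 x) atTop) '' S) with hL
    refine le_liminf_of_le (hbu y).isCoboundedUnder_ge ?_
    have hev : ∀ᶠ k : ℕ in atTop, ∀ x, x ∈ S →
        L - ε / 2 < (1 / (k : ℝ)) * (Tf T f)^[k] 0 x := by
      refine eventually_all.mpr fun x => ?_
      by_cases hx : x ∈ S
      · have h1 := csInf_le ((S.toFinite.image (fun x : X => Filter.liminf
          (fun k : ℕ => (1 / (k : ℝ)) * (Tf T f)^[k] 0 x) atTop)).bddBelow)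
          (Set.mem_image_of_mem _ hx)
        have h2 := eventually_lt_of_lt_liminf
          (lt_of_lt_of_le (by linarith : L - ε / 2 < L) h1) (hbl x)
        exact h2.mono fun k hk _ => hk
      · exact Eventually.of_forall fun k h => absurd h hx
    filter_upwards [hev, hCk (ε / 2) (by linarith), eventually_gt_atTop 0] with k h1 h2 hk
    have hk' : (0 : ℝ) < k := by exact_mod_cast hk
    have h3 := (hC k (k * (L - ε / 2))).2 (fun x hx => by
      have := h1 x hx
      rw [one_div, lt_inv_mul_iff₀ hk'] at this
      exact this.le) y
    rw [one_div, le_inv_mul_iff₀ hk']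
    linarith
  · refine le_of_forall_pos_le_add fun ε hε => ?_
    set L := sSup ((fun x : X => Filter.limsup
        (fun k : ℕ => (1 / (k : ℝ)) * (Tf T f)^[k] 0 x) atTop) '' S) with hL
    refine limsup_le_of_le (hbl y).isCoboundedUnder_le ?_
    have hev : ∀ᶠ k : ℕ in atTop, ∀ x, x ∈ S →
        (1 / (k : ℝ)) * (Tf T f)^[k] 0 x < L + ε / 2 := by
      refine eventually_all.mpr fun x => ?_
      by_cases hx : x ∈ S
      · have h1 := le_csSup ((S.toFinite.image (fun x : X => Filter.limsup
          (fun k : ℕ => (1 / (k : ℝ)) * (Tf T f)^[k] 0 x) atTop)).bddAbove)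
          (Set.mem_image_of_mem _ hx)
        have h2 := eventually_lt_of_limsup_lt
          (lt_of_le_of_lt h1 (by linarith : L < L + ε / 2)) (hbu x)
        exact h2.mono fun k hk _ => hk
      · exact Eventually.of_forall fun k h => absurd h hx
    filter_upwards [hev, hCk (ε / 2) (by linarith), eventually_gt_atTop 0] with k h1 h2 hk
    have hk' : (0 : ℝ) < k := by exact_mod_cast hk
    have h3 := (hC k (k * (L + ε / 2))).1 (fun x hx => by
      have := h1 x hx
      rw [one_div, inv_mul_lt_iff₀ hk'] at this
      exact this.le) y
    rw [one_div, inv_mul_le_iff₀ hk']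
    linarith

end WeakErg
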